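/- Let Ψ = {A_1, …, A_m} be a finite set of n×n SR-matrices. Then there exists w ∈ D_Ψ that is Pareto optimal for e_{A_1}, …, e_{A_m} with respect to D_Ψ: for every x ∈ D_Ψ, if e_{A_i}(x) ≤ e_{A_i}(w) for all i = 1,…,m, then e_{A_i}(x) = e_{A_i}(w) for all i. -/

import Mathlib

open Filter Relation

namespace MaxAlg

/-- Max-algebraic action of a matrix on a vector: `(A ⊗ x) i = max_j A i j * x j`. -/
noncomputable def maxVec {n : ℕ} (A : Fin n → Fin n → ℝ) (x : Fin n → ℝ) : Fin n → ℝ :=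
  fun i => ⨆ j, A i j * x j

/-- Max-algebraic matrix product: `(A ⊗ B) i k = max_j A i j * B j k`. -/
noncomputable def maxMul {n : ℕ} (A B : Fin n → Fin n → ℝ) : Fin n → Fin n → ℝ :=
  fun i k => ⨆ j, A i j * B j k

/-- The weight of the cycle determined by a list `[i₁, …, i_k]`,
namely `A i₁ i₂ * ⋯ * A i_{k-1} i_k * A i_k i₁`. -/
noncomputable def cycleProd {n : ℕ} (A : Fin n → Fin n → ℝ) (l : List (Fin n)) : ℝ :=
  ((l.zip (l.rotate 1)).map fun p => A p.1 p.2).prod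

/-- The maximal cycle geometric mean of `A`: the supremum over all cycles of distinct
nodes of the k-th root of the cycle weight. -/
noncomputable def mu {n : ℕ} (A : Fin n → Fin n → ℝ) : ℝ :=
  sSup {c | ∃ l : List (Fin n), l ≠ [] ∧ l.Nodup ∧ c = cycleProd A l ^ ((l.length : ℝ)⁻¹)}

/-- `C_{A,r}`: the positive vectors with `A ⊗ x ≤ r x`. -/
def Cset {n : ℕ} (A : Fin n → Fin n → ℝ) (r : ℝ) : Set (Fin n → ℝ) :=
  {x | (∀ i, 0 < x i) ∧ ∀ i, maxVec A x i ≤ r * x i}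

/-- A critical cycle: a cycle of distinct nodes attaining `mu A`. -/
def IsCriticalCycle {n : ℕ} (A : Fin n → Fin n → ℝ) (l : List (Fin n)) : Prop :=
  l ≠ [] ∧ l.Nodup ∧ cycleProd A l ^ ((l.length : ℝ)⁻¹) = mu A

/-- `(i,j) ∈ E^C(A)`: the edge `(i,j)` lies on some critical cycle. -/
def criticalEdge {n : ℕ} (A : Fin n → Fin n → ℝ) (i j : Fin n) : Prop :=
  ∃ l : List (Fin n), IsCriticalCycle A l ∧ (i, j) ∈ l.zip (l.rotate 1)

/-- `i ∈ N^C(A)`: the node `i` lies on some critical cycle. -/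
def criticalNode {n : ℕ} (A : Fin n → Fin n → ℝ) (i : Fin n) : Prop :=
  ∃ l : List (Fin n), IsCriticalCycle A l ∧ i ∈ l

/-- Irreducibility: the digraph of `A` (edge `(i,j)` iff `A i j > 0`) is strongly connected. -/
def Irred {n : ℕ} (A : Fin n → Fin n → ℝ) : Prop :=
  ∀ i j, Relation.ReflTransGen (fun a b => 0 < A a b) i j

/-- Max-algebraic product of a word of matrices from the family `A`. -/
noncomputable def wordProd {n m : ℕ} (A : Fin m → Fin n → Fin n → ℝ) :
    List (Fin m) → (Fin n → Fin n → ℝ)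
  | [] => fun i j => if i = j then 1 else 0
  | [j] => A j
  | j :: k :: w => maxMul (A j) (wordProd A (k :: w))

/-- The max version of the generalised spectral radius
`μ̂(Ψ) = limsup_{p→∞} (max_{ψ ∈ Ψ^p_⊗} μ(ψ))^{1/p}`. -/
noncomputable def genSpecRad {n m : ℕ} (A : Fin m → Fin n → Fin n → ℝ) : ℝ :=
  Filter.limsup
    (fun p : ℕ =>
      (sSup {c | ∃ w : List (Fin m), w.length = p ∧ c = mu (wordProd A w)}) ^ ((p : ℝ)⁻¹))
    Filter.atTop

/-- `S = A₁ ⊕ ⋯ ⊕ A_m`: the entrywise maximum of the family. -/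
noncomputable def Smat {n m : ℕ} (A : Fin m → Fin n → Fin n → ℝ) : Fin n → Fin n → ℝ :=
  fun i j => ⨆ k, A k i j

/-- The relative error function `e_A(x) = max_{i,j} A i j * x j / x i`. -/
noncomputable def errF {n : ℕ} (A : Fin n → Fin n → ℝ) (x : Fin n → ℝ) : ℝ :=
  ⨆ i, ⨆ j, A i j * x j / x i

/-- A symmetrically reciprocal (SR) matrix: positive, with unit diagonal and
`A i j * A j i = 1` for `i ≠ j`. -/
def IsSR {n : ℕ} (A : Fin n → Fin n → ℝ) : Prop :=
  (∀ i j, 0 < A i j) ∧ (∀ i, A i i = 1) ∧ ∀ i j, i ≠ j → A i j * A j i = 1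

/-- Max-algebraic matrix powers. -/
noncomputable def maxPow {n : ℕ} (B : Fin n → Fin n → ℝ) : ℕ → (Fin n → Fin n → ℝ)
  | 0 => fun i j => if i = j then 1 else 0
  | p + 1 => maxMul B (maxPow B p)

/-- The Kleene star `B* = I ⊕ B ⊕ B⊗² ⊕ ⋯ ⊕ B⊗^{n-1}`. -/
noncomputable def kleeneStar {n : ℕ} (B : Fin n → Fin n → ℝ) : Fin n → Fin n → ℝ :=
  fun i j => ⨆ p : Fin n, maxPow B p i j

lemma maxVec_le_iff {n : ℕ} (A : Fin (n + 1) → Fin (n + 1) → ℝ) (x : Fin (n + 1) → ℝ)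
    (i : Fin (n + 1)) (c : ℝ) : maxVec A x i ≤ c ↔ ∀ j, A i j * x j ≤ c :=
  ciSup_le_iff (Set.finite_range _).bddAbove

lemma continuousOn_errF {n : ℕ} (A : Fin (n + 1) → Fin (n + 1) → ℝ) :
    ContinuousOn (errF A) {x | ∀ i, 0 < x i} := by
  have key : ∀ f : Fin (n + 1) → (Fin (n + 1) → ℝ) → ℝ,
      (∀ i, ContinuousOn (f i) {x | ∀ i, 0 < x i}) →
      ContinuousOn (fun x => ⨆ i, f i x) {x | ∀ i, 0 < x i} := by
    intro f hf
    have : (fun x => ⨆ i, f i x) =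
        fun x => Finset.univ.sup' Finset.univ_nonempty (fun i => f i x) := by
      funext x
      rw [Finset.sup'_univ_eq_ciSup]
    rw [this]
    exact ContinuousOn.finset_sup'_apply _ fun i _ => hf i
  refine key _ fun i => key _ fun j => ?_
  refine ContinuousOn.div (by fun_prop) (by fun_prop) fun x hx => (hx i).ne'

lemma prod_map_nonneg_and_le_pow {n : ℕ} {A : Fin n → Fin n → ℝ} {M : ℝ}
    (h0 : ∀ i j, 0 ≤ A i j) (hM : ∀ i j, A i j ≤ M) (l : List (Fin n × Fin n)) :
    0 ≤ (l.map fun p => A p.1 p.2).prod ∧ (l.map fun p => A p.1 p.2).prod ≤ M ^ l.length := by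
  induction l with
  | nil => simp
  | cons p l ih =>
    simp only [List.map_cons, List.prod_cons, List.length_cons, pow_succ']
    exact ⟨mul_nonneg (h0 _ _) ih.1,
      mul_le_mul (hM _ _) ih.2 ih.1 ((h0 _ _).trans (hM p.1 p.2))⟩

lemma cycleMean_le {n : ℕ} {A : Fin n → Fin n → ℝ} {M : ℝ}
    (h0 : ∀ i j, 0 ≤ A i j) (hM : ∀ i j, A i j ≤ M) (hM0 : 0 ≤ M)
    {l : List (Fin n)} (hl : l ≠ []) :
    cycleProd A l ^ ((l.length : ℝ)⁻¹) ≤ M := by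
  have h := prod_map_nonneg_and_le_pow h0 hM (l.zip (l.rotate 1))
  rw [List.length_zip, List.length_rotate, min_self] at h
  have hlen : l.length ≠ 0 := by simpa using hl
  calc cycleProd A l ^ ((l.length : ℝ)⁻¹) ≤ (M ^ l.length) ^ ((l.length : ℝ)⁻¹) :=
        Real.rpow_le_rpow h.1 h.2 (by positivity)
    _ = M := Real.pow_rpow_inv_natCast hM0 hlen

lemma mu_le {n : ℕ} {A : Fin n → Fin n → ℝ} {M : ℝ}
    (h0 : ∀ i j, 0 ≤ A i j) (hM : ∀ i j, A i j ≤ M) (hM0 : 0 ≤ M) : mu A ≤ M := by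
  refine Real.sSup_le ?_ hM0
  rintro c ⟨l, hl, -, rfl⟩
  exact cycleMean_le h0 hM hM0 hl

lemma diag_le_mu {n : ℕ} {A : Fin n → Fin n → ℝ} {M : ℝ}
    (h0 : ∀ i j, 0 ≤ A i j) (hM : ∀ i j, A i j ≤ M) (hM0 : 0 ≤ M) (i : Fin n) :
    A i i ≤ mu A := by
  refine le_csSup ⟨M, ?_⟩ ⟨[i], by simp, by simp, by simp [cycleProd]⟩
  rintro c ⟨l, hl, -, rfl⟩
  exact cycleMean_le h0 hM hM0 hl

section WordProd

variable {n m : ℕ} {A : Fin m → Fin (n + 1) → Fin (n + 1) → ℝ}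

lemma exists_wordProd_cons_eq (k : Fin m) (w : List (Fin m)) (i l : Fin (n + 1)) :
    ∃ j, wordProd A (k :: w) i l = A k i j * wordProd A w j l := by
  cases w with
  | nil => exact ⟨l, by simp [wordProd]⟩
  | cons k' w =>
    obtain ⟨j, hj⟩ := exists_eq_ciSup_of_finite (f := fun j => A k i j * wordProd A (k' :: w) j l)
    exact ⟨j, hj.symm⟩

lemma mul_wordProd_le_wordProd_cons (h0 : ∀ k i j, 0 ≤ A k i j) (k : Fin m) (w : List (Fin m))
    (i j l : Fin (n + 1)) : A k i j * wordProd A w j l ≤ wordProd A (k :: w) i l := by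
  cases w with
  | nil =>
    simp only [wordProd]
    split_ifs with h
    · simp [h]
    · simpa using h0 k i l
  | cons k' w =>
    exact le_ciSup (f := fun j => A k i j * wordProd A (k' :: w) j l)
      (Set.finite_range _).bddAbove j

lemma wordProd_nonneg (h0 : ∀ k i j, 0 ≤ A k i j) (w : List (Fin m)) (i l : Fin (n + 1)) :
    0 ≤ wordProd A w i l := by
  induction w generalizing i with
  | nil => simp only [wordProd]; split_ifs <;> simp
  | cons k w ih =>
    obtain ⟨j, hj⟩ := exists_wordProd_cons_eq (A := A) k w i l
    exact hj ▸ mul_nonneg (h0 _ _ _) (ih j)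

lemma wordProd_le_pow (h0 : ∀ k i j, 0 ≤ A k i j) {M : ℝ} (hM0 : 0 ≤ M)
    (hM : ∀ k i j, A k i j ≤ M) (w : List (Fin m)) (i l : Fin (n + 1)) :
    wordProd A w i l ≤ M ^ w.length := by
  induction w generalizing i with
  | nil => simp only [wordProd]; split_ifs <;> simp
  | cons k w ih =>
    obtain ⟨j, hj⟩ := exists_wordProd_cons_eq (A := A) k w i l
    rw [hj, List.length_cons, pow_succ']
    exact mul_le_mul (hM _ _ _) (ih j) (wordProd_nonneg h0 _ _ _) hM0

lemma wordProd_mul_le_wordProd_append (h0 : ∀ k i j, 0 ≤ A k i j) (u v : List (Fin m))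
    (i j l : Fin (n + 1)) :
    wordProd A u i j * wordProd A v j l ≤ wordProd A (u ++ v) i l := by
  induction u generalizing i with
  | nil =>
    simp only [wordProd, List.nil_append]
    split_ifs with h
    · simp [h]
    · simpa using wordProd_nonneg h0 v i l
  | cons k u ih =>
    obtain ⟨a, ha⟩ := exists_wordProd_cons_eq (A := A) k u i j
    rw [ha, mul_assoc]
    exact (mul_le_mul_of_nonneg_left (ih a) (h0 _ _ _)).trans
      (mul_wordProd_le_wordProd_cons h0 _ _ _ _ _)

lemma pow_wordProd_diag_le (h0 : ∀ k i j, 0 ≤ A k i j) (w : List (Fin m)) (i : Fin (n + 1))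
    (q : ℕ) : wordProd A w i i ^ q ≤ wordProd A (List.replicate q w).flatten i i := by
  induction q with
  | zero => simp [wordProd]
  | succ q ih =>
    rw [pow_succ', List.replicate_succ, List.flatten_cons]
    exact (mul_le_mul_of_nonneg_left ih (wordProd_nonneg h0 _ _ _)).trans
      (wordProd_mul_le_wordProd_append h0 _ _ _ _ _)

lemma wordProd_diag_le_genSpecRad_pow (h0 : ∀ k i j, 0 ≤ A k i j) {w : List (Fin m)}
    (hw : w ≠ []) (i : Fin (n + 1)) : wordProd A w i i ≤ genSpecRad A ^ w.length := by
  obtain ⟨M, hM⟩ := (Set.finite_range fun t : Fin m × Fin (n + 1) × Fin (n + 1) =>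
    A t.1 t.2.1 t.2.2).bddAbove
  have hM : ∀ k i j, A k i j ≤ M := fun k i j => hM ⟨(k, i, j), rfl⟩
  obtain ⟨k₀, -⟩ := List.exists_mem_of_ne_nil w hw
  have hM0 : 0 ≤ M := (h0 k₀ i i).trans (hM k₀ i i)
  have hmu : ∀ w : List (Fin m), mu (wordProd A w) ≤ M ^ w.length := fun w =>
    mu_le (wordProd_nonneg h0 w) (wordProd_le_pow h0 hM0 hM w) (by positivity)
  have hdiag : ∀ w : List (Fin m), wordProd A w i i ≤ mu (wordProd A w) := fun w =>
    diag_le_mu (wordProd_nonneg h0 w) (wordProd_le_pow h0 hM0 hM w) (by positivity) i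
  have hlen : w.length ≠ 0 := by simpa using hw
  have hc := wordProd_nonneg h0 w i i
  have hroot : wordProd A w i i ^ ((w.length : ℝ)⁻¹) ≤ genSpecRad A := by
    refine Filter.le_limsup_of_frequently_le ?_ ?_
    · refine Filter.frequently_atTop.2 fun N =>
        ⟨w.length * (N + 1), by nlinarith [Nat.pos_of_ne_zero hlen], ?_⟩
      have hq : wordProd A w i i ^ (N + 1) ≤ sSup {c | ∃ v : List (Fin m),
          v.length = w.length * (N + 1) ∧ c = mu (wordProd A v)} := by
        refine ((pow_wordProd_diag_le h0 w i (N + 1)).trans (hdiag _)).trans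
          (le_csSup ⟨M ^ (w.length * (N + 1)), ?_⟩ ⟨_, ?_, rfl⟩)
        · rintro c ⟨v, hv, rfl⟩
          exact hv ▸ hmu v
        · simp [mul_comm]
      refine le_trans (le_of_eq ?_) (Real.rpow_le_rpow (by positivity) hq (by positivity))
      rw [Nat.cast_mul, mul_inv, mul_comm, Real.rpow_mul (by positivity),
        Real.pow_rpow_inv_natCast hc (by simp)]
    · refine Filter.isBoundedUnder_of_eventually_le (a := M) ?_
      filter_upwards [Filter.eventually_ne_atTop 0] with p hp
      have hle : sSup {c | ∃ v : List (Fin m), v.length = p ∧ c = mu (wordProd A v)} ≤ M ^ p := by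
        refine Real.sSup_le ?_ (by positivity)
        rintro c ⟨v, hv, rfl⟩
        exact hv ▸ hmu v
      have hnn : 0 ≤ sSup {c | ∃ v : List (Fin m), v.length = p ∧ c = mu (wordProd A v)} := by
        refine Real.sSup_nonneg ?_
        rintro c ⟨v, hv, rfl⟩
        exact (wordProd_nonneg h0 v i i).trans (hdiag v)
      exact (Real.rpow_le_rpow hnn hle (by positivity)).trans_eq
        (Real.pow_rpow_inv_natCast hM0 hp)
  calc wordProd A w i i = (wordProd A w i i ^ ((w.length : ℝ)⁻¹)) ^ w.length :=
        (Real.rpow_inv_natCast_pow hc hlen).symm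
    _ ≤ genSpecRad A ^ w.length := pow_le_pow_left₀ (by positivity) hroot _

lemma genSpecRad_pos (hA : ∀ k i j, 0 < A k i j) (hm : 0 < m) : 0 < genSpecRad A := by
  have h := wordProd_diag_le_genSpecRad_pow (fun k i j => (hA k i j).le)
    (w := [(⟨0, hm⟩ : Fin m)]) (by simp) 0
  simp only [wordProd, List.length_singleton, pow_one] at h
  exact (hA _ _ _).trans_le h

lemma exists_common_subeigenvector (hA : ∀ k i j, 0 < A k i j) (hm : 0 < m) :
    ∃ x : Fin (n + 1) → ℝ, (∀ i, 0 < x i) ∧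
      ∀ k i j, A k i j * x j ≤ genSpecRad A * x i := by
  have h0 : ∀ k i j, 0 ≤ A k i j := fun k i j => (hA k i j).le
  have hr := genSpecRad_pos hA hm
  let f : Fin (n + 1) → List (Fin m) → ℝ := fun i w =>
    wordProd A w i 0 / genSpecRad A ^ w.length
  have hbdd : ∀ i, BddAbove (Set.range (f i)) := by
    refine fun i => ⟨genSpecRad A / A ⟨0, hm⟩ 0 i, ?_⟩
    rintro _ ⟨w, rfl⟩
    rw [div_le_div_iff₀ (by positivity) (hA _ _ _), ← pow_succ', mul_comm]
    exact (mul_wordProd_le_wordProd_cons h0 ⟨0, hm⟩ w 0 i 0).trans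
      (wordProd_diag_le_genSpecRad_pow h0 (by simp) 0)
  refine ⟨fun i => ⨆ w, f i w, fun i => ?_, fun k i j => ?_⟩
  · refine lt_of_lt_of_le ?_ (le_ciSup (hbdd i) [⟨0, hm⟩])
    simpa [f, wordProd] using div_pos (hA _ _ _) hr
  · rw [Real.mul_iSup_of_nonneg (h0 k i j)]
    refine ciSup_le fun w => ?_
    refine le_trans ?_ (mul_le_mul_of_nonneg_left (le_ciSup (hbdd i) (k :: w)) hr.le)
    simp only [f, List.length_cons, pow_succ']
    rw [← mul_div_assoc, ← mul_div_assoc, mul_div_mul_left _ _ hr.ne']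
    exact div_le_div_of_nonneg_right (mul_wordProd_le_wordProd_cons h0 k w i j 0) (by positivity)

end WordProd

lemma isCompact_common_subeigenvectors {n m : ℕ} (hm : 0 < m)
    {A : Fin m → Fin (n + 1) → Fin (n + 1) → ℝ} (hA : ∀ k i j, 0 < A k i j) {r : ℝ}
    (hr : 0 < r) : IsCompact {x ∈ ⋂ k, Cset (A k) r | x 0 = 1} := by
  have heq : {x ∈ ⋂ k, Cset (A k) r | x 0 = 1} =
      Set.Icc (fun i => A ⟨0, hm⟩ i 0 / r) (fun i => r / A ⟨0, hm⟩ 0 i) ∩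
        {x | x 0 = 1 ∧ ∀ k i j, A k i j * x j ≤ r * x i} := by
    ext x
    simp only [Cset, maxVec_le_iff, Set.mem_ofPred_eq, Set.mem_iInter, Set.mem_inter_iff,
      Set.mem_Icc, Pi.le_def]
    constructor
    · rintro ⟨h, h1⟩
      refine ⟨⟨fun i => ?_, fun i => ?_⟩, h1, fun k => (h k).2⟩
      · rw [div_le_iff₀' hr]
        simpa [h1] using (h ⟨0, hm⟩).2 i 0
      · rw [le_div_iff₀' (hA _ _ _)]
        simpa [h1] using (h ⟨0, hm⟩).2 0 i
    · rintro ⟨⟨hl, -⟩, h1, h⟩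
      exact ⟨fun k => ⟨fun i => (div_pos (hA _ _ _) hr).trans_le (hl i), h k⟩, h1⟩
  rw [heq]
  refine isCompact_Icc.inter_right ?_
  simp only [Set.ofPred_and, Set.ofPred_forall]
  refine (isClosed_eq (by fun_prop) (by fun_prop)).inter ?_
  exact isClosed_iInter fun k => isClosed_iInter fun i => isClosed_iInter fun j =>
    isClosed_le (by fun_prop) (by fun_prop)

/-- for a finite family of SR-matrices there exists a point of
`D_Ψ = {x ∈ C_{Ψ,μ̂(Ψ)} : x 1 = 1}` that is Pareto optimal with respect to `D_Ψ`. -/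
theorem stmt17 {n m : ℕ} (hm : 0 < m) (A : Fin m → Fin (n + 1) → Fin (n + 1) → ℝ)
    (hSR : ∀ k, IsSR (A k)) :
    ∃ w ∈ {x ∈ ⋂ k, Cset (A k) (genSpecRad A) | x 0 = 1},
      ∀ x ∈ {x ∈ ⋂ k, Cset (A k) (genSpecRad A) | x 0 = 1},
        (∀ k, errF (A k) x ≤ errF (A k) w) → ∀ k, errF (A k) x = errF (A k) w := by
  have hA : ∀ k i j, 0 < A k i j := fun k => (hSR k).1
  have hr := genSpecRad_pos hA hm
  have hne : {x ∈ ⋂ k, Cset (A k) (genSpecRad A) | x 0 = 1}.Nonempty := by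
    obtain ⟨x, hx, hAx⟩ := exists_common_subeigenvector hA hm
    refine ⟨fun i => x i / x 0, Set.mem_iInter.2 fun k => ⟨fun i => div_pos (hx i) (hx 0),
      fun i => (maxVec_le_iff _ _ _ _).2 fun j => ?_⟩, div_self (hx 0).ne'⟩
    rw [← mul_div_assoc, ← mul_div_assoc]
    exact div_le_div_of_nonneg_right (hAx k i j) (hx 0).le
  have hcont : ContinuousOn (fun x => ∑ k, errF (A k) x)
      {x ∈ ⋂ k, Cset (A k) (genSpecRad A) | x 0 = 1} :=
    continuousOn_finsetSum _ fun k _ => (continuousOn_errF (A k)).mono fun x hx =>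
      (Set.mem_iInter.1 hx.1 k).1
  obtain ⟨w, hw, hmin⟩ := (isCompact_common_subeigenvectors hm hA hr).exists_isMinOn hne hcont
  refine ⟨w, hw, fun x hx hle k => ?_⟩
  exact (Finset.sum_eq_sum_iff_of_le fun k _ => hle k).1
    ((Finset.sum_le_sum fun k _ => hle k).antisymm (hmin hx)) k (Finset.mem_univ k)

end MaxAlg
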